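/- (Independence of connection) Let k be a field of characteristic zero, g a (k,A)-Lie-Rinehart algebra and W a finite free A-module. If ∇₀ and ∇₁ are two g-connections on W, then for each n the cohomology classes [tr(R_{∇₀}^n)] and [tr(R_{∇₁}^n)] in H^{2n}(g,A) are equal; hence the Chern character ch^g(W,∇) is independent of the choice of connection. -/

import Mathlib

open scoped TensorProduct BigOperators

structure LieRinehart (k A g : Type*) [CommRing k] [CommRing A] [Algebra k A]
    [LieRing g] [LieAlgebra k g] [Module A g] [IsScalarTower k A g] where
  anchor : g → Module.End k A
  anchor_add : ∀ x y : g, anchor (x + y) = anchor x + anchor y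
  anchor_smul : ∀ (a : A) (x : g) (b : A), anchor (a • x) b = a * anchor x b
  anchor_leibniz : ∀ (x : g) (a b : A), anchor x (a * b) = a * anchor x b + anchor x a * b
  anchor_bracket : ∀ x y : g, anchor ⁅x, y⁆ = ⁅anchor x, anchor y⁆
  bracket_smul : ∀ (a : A) (x y : g), ⁅x, a • y⁆ = a • ⁅x, y⁆ + anchor x a • y

variable {k A g : Type*} [Field k] [CharZero k] [CommRing A] [Algebra k A]
  [LieRing g] [LieAlgebra k g] [Module A g] [IsScalarTower k A g]

structure LRConnection (L : LieRinehart k A g) (W : Type*) [AddCommGroup W]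
    [Module k W] [Module A W] [IsScalarTower k A W] where
  conn : g → Module.End k W
  conn_add : ∀ x y : g, conn (x + y) = conn x + conn y
  conn_smul : ∀ (a : A) (x : g) (w : W), conn (a • x) w = a • conn x w
  leibniz : ∀ (x : g) (a : A) (w : W), conn x (a • w) = a • conn x w + L.anchor x a • w

variable {L : LieRinehart k A g}
variable {W W' : Type*} [AddCommGroup W] [Module k W] [Module A W] [IsScalarTower k A W]
  [AddCommGroup W'] [Module k W'] [Module A W'] [IsScalarTower k A W']

/-- The curvature of a connection, as a `k`-linear endomorphism. -/
def curvK (D : LRConnection L W) (x y : g) : Module.End k W :=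
  ⁅D.conn x, D.conn y⁆ - D.conn ⁅x, y⁆

/-- Remove the entries at positions `i < j` from a tuple. -/
def remove2 {n : ℕ} (v : Fin (n + 2) → g) (i j : Fin (n + 2)) (h : i < j) : Fin n → g :=
  fun m =>
    v (i.succAbove ((j.pred (by rintro rfl; exact absurd h (by simp))).succAbove m))

/-- The Lie–Rinehart (Chevalley–Eilenberg style) differential on cochains with values in a
module with connection. -/
noncomputable def lrD (D : LRConnection L W) {p : ℕ}
    (ψ : (Fin (p + 1) → g) → W) : (Fin (p + 2) → g) → W := fun v =>
  (∑ i : Fin (p + 2), ((-1 : ℤ) ^ (i : ℕ)) • D.conn (v i) (ψ fun m => v (i.succAbove m)))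
    + ∑ i : Fin (p + 2), ∑ j : Fin (p + 2),
        if h : i < j then
          ((-1 : ℤ) ^ ((i : ℕ) + (j : ℕ))) • ψ (Fin.cons ⁅v i, v j⁆ (remove2 v i j h))
        else 0

/-- The canonical connection on `A` itself, given by the anchor map. -/
def anchorConnection (L : LieRinehart k A g) : LRConnection L A where
  conn := L.anchor
  conn_add := L.anchor_add
  conn_smul := fun a x w => by rw [L.anchor_smul, smul_eq_mul]
  leibniz := fun x a w => by
    simp only [smul_eq_mul]; rw [L.anchor_leibniz]

/-- The induced action `ad∇` of a connection on `End_A(W)`. -/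
noncomputable def adAct (D : LRConnection L W) (x : g) (φ : W →ₗ[A] W) : W →ₗ[A] W where
  toFun w := D.conn x (φ w) - φ (D.conn x w)
  map_add' u v := by simp only [map_add]; abel
  map_smul' a w := by
    simp only [map_smul, RingHom.id_apply, D.leibniz, map_add, smul_sub]
    abel

/-- The Lie–Rinehart differential on `End_A(W)`-valued cochains, using `ad∇`. -/
noncomputable def lrDEnd (D : LRConnection L W) {p : ℕ}
    (ψ : (Fin (p + 1) → g) → (W →ₗ[A] W)) : (Fin (p + 2) → g) → (W →ₗ[A] W) := fun v =>
  (∑ i : Fin (p + 2), ((-1 : ℤ) ^ (i : ℕ)) • adAct D (v i) (ψ fun m => v (i.succAbove m)))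
    + ∑ i : Fin (p + 2), ∑ j : Fin (p + 2),
        if h : i < j then
          ((-1 : ℤ) ^ ((i : ℕ) + (j : ℕ))) • ψ (Fin.cons ⁅v i, v j⁆ (remove2 v i j h))
        else 0

/-- `σ` is a `(p,q)`-shuffle: strictly increasing on the first `p` and the last `q` positions. -/
def IsShuffle (p q : ℕ) (σ : Equiv.Perm (Fin (p + q))) : Prop :=
  (∀ i j : Fin (p + q), i < j → (j : ℕ) < p → σ i < σ j) ∧
    (∀ i j : Fin (p + q), i < j → p ≤ (i : ℕ) → σ i < σ j)

open Classical in
/-- The exterior (shuffle) product of cochains, combined with a product `f` on values. -/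
noncomputable def wedge {α β γ : Type*} [AddCommGroup γ] {p q : ℕ}
    (x : (Fin p → g) → α) (y : (Fin q → g) → β) (f : α → β → γ) :
    (Fin (p + q) → g) → γ := fun v =>
  ∑ σ : Equiv.Perm (Fin (p + q)),
    if IsShuffle p q σ then
      ((Equiv.Perm.sign σ : ℤ)) •
        f (x fun i => v (σ (Fin.castAdd q i))) (y fun i => v (σ (Fin.natAdd p i)))
    else 0

/-- Wedge powers of an `End_A(W)`-valued `2`-cochain (e.g. the curvature); `powC R n = R^n`. -/
noncomputable def powC (R : (Fin 2 → g) → (W →ₗ[A] W)) :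
    (n : ℕ) → (Fin (2 * n) → g) → (W →ₗ[A] W)
  | 0 => fun _ => LinearMap.id
  | n + 1 => wedge (powC R n) R fun f1 f2 => f1 ∘ₗ f2

/-- Reindexing a tuple along an equality of lengths. -/
def recast {n m : ℕ} (h : n = m) (v : Fin m → g) : Fin n → g := fun i => v (Fin.cast h i)

set_option linter.unusedSectionVars false

/-! ### Signed sums over permutations -/

/-- The unnormalised antisymmetrisation of a function of `N` variables. -/
def altSum {X M : Type*} [AddCommGroup M] {N : ℕ} (F : (Fin N → X) → M) (v : Fin N → X) : M :=
  ∑ σ : Equiv.Perm (Fin N), (Equiv.Perm.sign σ : ℤ) • F (v ∘ σ)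

section AltSum

variable {X M M' : Type*} [AddCommGroup M] [AddCommGroup M'] {N : ℕ}

theorem altSum_comp_perm (F : (Fin N → X) → M) (τ : Equiv.Perm (Fin N)) (v : Fin N → X) :
    altSum (fun u => F (u ∘ τ)) v = (Equiv.Perm.sign τ : ℤ) • altSum F v := by
  unfold altSum
  rw [← Equiv.sum_comp (Equiv.mulRight τ) (fun σ => (Equiv.Perm.sign σ : ℤ) • F (v ∘ σ)),
    Finset.smul_sum]
  refine Finset.sum_congr rfl fun σ _ => ?_
  rw [smul_smul]
  congr 1
  have : (Equiv.Perm.sign τ : ℤ) * Equiv.Perm.sign τ = 1 := by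
    rw [← Units.val_mul, Int.units_mul_self, Units.val_one]
  simp only [Equiv.coe_mulRight, Equiv.Perm.sign_mul, Units.val_mul]
  linear_combination -(Equiv.Perm.sign σ : ℤ) * this

theorem altSum_add (F G : (Fin N → X) → M) (v : Fin N → X) :
    altSum (fun u => F u + G u) v = altSum F v + altSum G v := by
  simp [altSum, Finset.sum_add_distrib]

theorem altSum_sub (F G : (Fin N → X) → M) (v : Fin N → X) :
    altSum (fun u => F u - G u) v = altSum F v - altSum G v := by
  simp [altSum, smul_sub, Finset.sum_sub_distrib]

theorem altSum_map (T : M →+ M') (F : (Fin N → X) → M) (v : Fin N → X) :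
    altSum (fun u => T (F u)) v = T (altSum F v) := by
  simp only [altSum, map_sum, map_zsmul]

/-- Expansion of a signed sum along the first entry, using that a permutation of `Fin (N + 1)` is
determined by its value at `0` and a permutation of the
remaining entries. -/
theorem altSum_succ (F : (Fin (N + 1) → X) → M) (v : Fin (N + 1) → X) :
    altSum F v = ∑ i : Fin (N + 1), ((-1 : ℤ) ^ (i : ℕ)) •
      altSum (fun w => F (Fin.cons (v i) w)) (fun m => v (i.succAbove m)) := by
  let e : Fin (N + 1) × Equiv.Perm (Fin N) → Equiv.Perm (Fin (N + 1)) :=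
    fun x => x.1.cycleRange.symm * Equiv.Perm.decomposeFin.symm (0, x.2)
  have e0 : ∀ x, e x 0 = x.1 := fun x => by simp [e]
  have es : ∀ x m, e x (Fin.succ m) = x.1.succAbove (x.2 m) := fun x m => by simp [e]
  have einj : Function.Injective e := by
    rintro ⟨i, σ⟩ ⟨j, τ⟩ h
    obtain rfl : i = j := by simpa [e0] using congrArg (fun f => f 0) h
    congr 1
    ext m : 1
    simpa [es] using congrArg (fun f => f (Fin.succ m)) h
  have ebij : Function.Bijective e := by
    rw [Fintype.bijective_iff_injective_and_card]
    refine ⟨einj, ?_⟩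
    simp [Fintype.card_perm, Nat.factorial_succ]
  unfold altSum
  rw [← (Equiv.ofBijective e ebij).sum_comp, Fintype.sum_prod_type]
  refine Finset.sum_congr rfl fun i _ => ?_
  rw [Finset.smul_sum]
  refine Finset.sum_congr rfl fun σ _ => ?_
  rw [smul_smul]
  congr 1
  · have : (Equiv.Perm.sign (e (i, σ)) : ℤ) = (-1) ^ (i : ℕ) * Equiv.Perm.sign σ := by
      simp [e, Equiv.Perm.sign_mul, Equiv.Perm.decomposeFin.symm_sign]
    simpa using this
  · congr 1
    funext m
    refine Fin.cases ?_ (fun m => ?_) m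
    · simp [e0]
    · simp [es]

end AltSum

/-! ### Wedge products of antisymmetrised functions -/

section WedgeAltSum

variable {p q : ℕ}

/-- The block permutation of `Fin (p + q)`. -/
def blockPerm (τ : Equiv.Perm (Fin p)) (ρ : Equiv.Perm (Fin q)) : Equiv.Perm (Fin (p + q)) :=
  finSumFinEquiv.permCongr (Equiv.Perm.sumCongr τ ρ)

theorem blockPerm_castAdd (τ : Equiv.Perm (Fin p)) (ρ : Equiv.Perm (Fin q)) (i : Fin p) :
    blockPerm τ ρ (Fin.castAdd q i) = Fin.castAdd q (τ i) := by
  simp [blockPerm, Equiv.permCongr_apply]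

theorem blockPerm_natAdd (τ : Equiv.Perm (Fin p)) (ρ : Equiv.Perm (Fin q)) (i : Fin q) :
    blockPerm τ ρ (Fin.natAdd p i) = Fin.natAdd p (ρ i) := by
  simp [blockPerm, Equiv.permCongr_apply]

theorem sign_blockPerm (τ : Equiv.Perm (Fin p)) (ρ : Equiv.Perm (Fin q)) :
    Equiv.Perm.sign (blockPerm τ ρ) = Equiv.Perm.sign τ * Equiv.Perm.sign ρ := by
  simp [blockPerm, Equiv.Perm.sign_permCongr, Equiv.Perm.sign_sumCongr]

theorem isShuffle_iff (σ : Equiv.Perm (Fin (p + q))) :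
    IsShuffle p q σ ↔ StrictMono (fun i => σ (Fin.castAdd q i)) ∧
      StrictMono (fun i => σ (Fin.natAdd p i)) := by
  constructor
  · rintro ⟨h1, h2⟩
    refine ⟨fun i j hij => h1 _ _ ?_ ?_, fun i j hij => h2 _ _ ?_ ?_⟩
    · exact hij
    · simp
    · simpa using hij
    · simp
  · rintro ⟨h1, h2⟩
    refine ⟨fun i j hij hj => ?_, fun i j hij hi => ?_⟩
    · have := @h1 ⟨i, by rw [Fin.lt_def] at hij; omega⟩ ⟨j, hj⟩ hij
      exact this
    · have := @h2 ⟨i - p, by omega⟩ ⟨j - p, by omega⟩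
        (by simp only [Fin.lt_def] at hij ⊢; omega)
      have ei : Fin.natAdd p (⟨i - p, by omega⟩ : Fin q) = i := by ext; simp; omega
      have ej : Fin.natAdd p (⟨j - p, by rw [Fin.lt_def] at hij; omega⟩ : Fin q) = j := by
        ext; simp; rw [Fin.lt_def] at hij; omega
      simpa only [ei, ej] using this

theorem bijective_shuffle_mul_blockPerm :
    Function.Bijective (fun x : {σ : Equiv.Perm (Fin (p + q)) // IsShuffle p q σ} ×
      Equiv.Perm (Fin p) × Equiv.Perm (Fin q) => x.1.1 * blockPerm x.2.1 x.2.2) := by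
  constructor
  · rintro ⟨⟨σ, hσ⟩, τ, ρ⟩ ⟨⟨σ', hσ'⟩, τ', ρ'⟩ h
    rw [isShuffle_iff] at hσ hσ'
    have h1 : ∀ i, σ (Fin.castAdd q (τ i)) = σ' (Fin.castAdd q (τ' i)) := fun i => by
      simpa [blockPerm_castAdd] using congrArg (fun f => f (Fin.castAdd q i)) h
    have h2 : ∀ i, σ (Fin.natAdd p (ρ i)) = σ' (Fin.natAdd p (ρ' i)) := fun i => by
      simpa [blockPerm_natAdd] using congrArg (fun f => f (Fin.natAdd p i)) h
    have r1 : (fun i => σ (Fin.castAdd q i)) = (fun i => σ' (Fin.castAdd q i)) := by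
      rw [← StrictMono.range_inj hσ.1 hσ'.1,
        ← τ.surjective.range_comp (fun i => σ (Fin.castAdd q i)),
        ← τ'.surjective.range_comp (fun i => σ' (Fin.castAdd q i))]
      exact congrArg Set.range (funext h1)
    have r2 : (fun i => σ (Fin.natAdd p i)) = (fun i => σ' (Fin.natAdd p i)) := by
      rw [← StrictMono.range_inj hσ.2 hσ'.2,
        ← ρ.surjective.range_comp (fun i => σ (Fin.natAdd p i)),
        ← ρ'.surjective.range_comp (fun i => σ' (Fin.natAdd p i))]
      exact congrArg Set.range (funext h2)
    have hs : σ = σ' := by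
      ext1 i
      refine Fin.addCases (fun i => ?_) (fun i => ?_) i
      · exact congrFun r1 i
      · exact congrFun r2 i
    subst hs
    have ht : τ = τ' := by
      ext1 i
      simpa using h1 i
    have hr : ρ = ρ' := by
      ext1 i
      simpa using h2 i
    subst ht hr
    rfl
  · intro π
    let a := Tuple.sort (fun i => π (Fin.castAdd q i))
    let b := Tuple.sort (fun i => π (Fin.natAdd p i))
    refine ⟨⟨⟨π * blockPerm a b, ?_⟩, a⁻¹, b⁻¹⟩, ?_⟩
    · rw [isShuffle_iff]
      constructor
      · refine Monotone.strictMono_of_injective ?_ ?_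
        · intro i j h
          have := Tuple.monotone_sort (fun i => π (Fin.castAdd q i)) h
          simp only [Equiv.Perm.mul_apply, blockPerm_castAdd]
          exact this
        · intro i j h
          simpa using h
      · refine Monotone.strictMono_of_injective ?_ ?_
        · intro i j h
          have := Tuple.monotone_sort (fun i => π (Fin.natAdd p i)) h
          simp only [Equiv.Perm.mul_apply, blockPerm_natAdd]
          exact this
        · intro i j h
          simpa using h
    · ext1 i
      refine Fin.addCases (fun i => ?_) (fun i => ?_) i
      · simp [blockPerm_castAdd]
      · simp [blockPerm_natAdd]

theorem wedge_altSum {X α β γ : Type*} [AddCommGroup α] [AddCommGroup β] [AddCommGroup γ]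
    (x : (Fin p → X) → α) (y : (Fin q → X) → β) (f : α →+ β →+ γ) (v : Fin (p + q) → X) :
    wedge (altSum x) (altSum y) (fun a b => f a b) v =
      altSum (fun u => f (x fun i => u (Fin.castAdd q i)) (y fun i => u (Fin.natAdd p i))) v := by
  classical
  unfold wedge
  conv_rhs => unfold altSum
  refine Eq.trans ?_ (Equiv.sum_comp
    (Equiv.ofBijective _ (bijective_shuffle_mul_blockPerm (p := p) (q := q))) _)
  rw [Fintype.sum_prod_type, ← Finset.sum_filter, ← Finset.sum_subtype_eq_sum_filter]
  simp only [Finset.subtype_univ]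
  refine Finset.sum_congr rfl fun σ _ => ?_
  rw [Fintype.sum_prod_type]
  simp only [altSum, map_sum, AddMonoidHom.finsetSum_apply, map_zsmul, AddMonoidHom.coe_smul,
    Pi.smul_apply, Finset.smul_sum]
  rw [Finset.sum_comm]
  refine Finset.sum_congr rfl fun τ _ => Finset.sum_congr rfl fun ρ _ => ?_
  simp only [Equiv.ofBijective_apply, Equiv.Perm.sign_mul, sign_blockPerm, Units.val_mul,
    smul_smul, Function.comp_def, Equiv.Perm.mul_apply, blockPerm_castAdd, blockPerm_natAdd]
  congr 1
  ring

end WedgeAltSum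

/-! ### The differential of an alternatization -/

theorem alternatization_eq_altSum {p : ℕ} (f : MultilinearMap A (fun _ : Fin p => g) A)
    (v : Fin p → g) : MultilinearMap.alternatization f v = altSum f v := by
  simp [MultilinearMap.alternatization_apply, altSum, Function.comp_def, Units.smul_def]

/-- Moving the entry at position `j` of an alternating map to the front. -/
theorem map_update_eq_cons {p : ℕ} (X : AlternatingMap A g A (Fin (p + 1)))
    (w : Fin (p + 1) → g) (j : Fin (p + 1)) (c : g) :
    X (Function.update w j c) =
      ((-1 : ℤ) ^ (j : ℕ)) • X (Fin.cons c (fun m => w (j.succAbove m))) := by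
  have h : (Fin.cons c (fun m => w (j.succAbove m)) : Fin (p + 1) → g) =
      Function.update w j c ∘ j.cycleRange.symm := by
    funext m
    refine Fin.cases ?_ (fun m => ?_) m
    · simp
    · simp [Fin.succAbove_ne]
  rw [h, AlternatingMap.map_perm, Equiv.Perm.sign_symm, Fin.sign_cycleRange, Units.smul_def,
    smul_smul]
  push_cast
  rw [← mul_pow]
  simp

theorem sum_map_update_bracket {p : ℕ} (X : AlternatingMap A g A (Fin (p + 1)))
    (v : Fin (p + 2) → g) :
    ∑ i : Fin (p + 2), ((-1 : ℤ) ^ (i : ℕ)) • ∑ j : Fin (p + 1),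
        X (Function.update (fun m => v (i.succAbove m)) j ⁅v i, v (i.succAbove j)⁆) =
      (-2 : ℤ) • ∑ i : Fin (p + 2), ∑ j : Fin (p + 2),
        if h : i < j then
          ((-1 : ℤ) ^ ((i : ℕ) + (j : ℕ))) • X (Fin.cons ⁅v i, v j⁆ (remove2 v i j h))
        else 0 := by
  set Q : Fin (p + 2) → Fin (p + 2) → A := fun i j =>
    if h : i < j then
      ((-1 : ℤ) ^ ((i : ℕ) + (j : ℕ))) • X (Fin.cons ⁅v i, v j⁆ (remove2 v i j h))
    else 0 with hQ
  have key : ∀ (i : Fin (p + 2)) (j : Fin (p + 1)), ((-1 : ℤ) ^ (i : ℕ)) •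
      X (Function.update (fun m => v (i.succAbove m)) j ⁅v i, v (i.succAbove j)⁆) =
      -(Q i (i.succAbove j) + Q (i.succAbove j) i) := by
    intro i j
    rw [map_update_eq_cons, smul_smul, ← pow_add]
    rcases lt_or_gt_of_ne (Fin.succAbove_ne i j) with h | h
    · have hj : i.succAbove j = j.castSucc := by
        apply Fin.succAbove_of_castSucc_lt
        rcases Fin.castSucc_lt_or_lt_succ i j with h' | h'
        · exact h'
        · rw [Fin.succAbove_of_lt_succ _ _ h'] at h
          exact absurd h' (not_lt.mpr h.le)
      revert h
      rw [hj]
      intro h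
      simp only [hQ, dif_neg (not_lt.mpr h.le), dif_pos h, zero_add]
      have hs : (Fin.cons ⁅v i, v j.castSucc⁆
            (fun m => v (i.succAbove (j.succAbove m))) : Fin (p + 1) → g) =
          Function.update (Fin.cons ⁅v j.castSucc, v i⁆
            (remove2 v j.castSucc i h)) 0 ((-1 : A) • ⁅v j.castSucc, v i⁆) := by
        rw [Fin.update_cons_zero, neg_smul, one_smul, lie_skew]
        congr 1
        funext m
        unfold remove2
        congr 1
        rw [Fin.lt_def] at h
        ext
        simp only [Fin.succAbove, Fin.lt_def, Fin.val_castSucc, Fin.val_pred] at *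
        split_ifs <;> simp_all <;> omega
      rw [hs, AlternatingMap.map_update_smul, Fin.update_cons_zero, Fin.val_castSucc,
        add_comm (i : ℕ), neg_smul, one_smul, smul_neg]
    · have hj : i.succAbove j = j.succ := by
        apply Fin.succAbove_of_lt_succ
        rcases Fin.castSucc_lt_or_lt_succ i j with h' | h'
        · rw [Fin.succAbove_of_castSucc_lt _ _ h'] at h
          exact absurd h' (not_lt.mpr h.le)
        · exact h'
      revert h
      rw [hj]
      intro h
      simp only [hQ, dif_neg (not_lt.mpr h.le), dif_pos h, add_zero]
      have hr : (fun m => v (i.succAbove (j.succAbove m))) = remove2 v i j.succ h := by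
        funext m
        unfold remove2
        simp only [Fin.pred_succ]
      rw [hr, ← neg_smul]
      congr 1
      rw [Fin.val_succ]
      ring
  have hd : ∀ i, Q i i = 0 := fun i => by simp [hQ]
  have e1 : ∀ i, ∑ j, Q i (i.succAbove j) = ∑ j, Q i j := fun i => by
    rw [Fin.sum_univ_succAbove _ i, hd, zero_add]
  have e2 : ∀ i, ∑ j, Q (i.succAbove j) i = ∑ j, Q j i := fun i => by
    rw [Fin.sum_univ_succAbove (fun j => Q j i) i, hd, zero_add]
  simp only [Finset.smul_sum, key]
  simp only [Finset.sum_neg_distrib, Finset.sum_add_distrib, e1, e2]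
  rw [Finset.sum_comm (f := fun i j => Q j i), ← two_smul ℤ, ← neg_smul]
  simp only [Finset.smul_sum]
  rfl

theorem two_smul_lrD_alternatization (L : LieRinehart k A g) {p : ℕ}
    (f : MultilinearMap A (fun _ : Fin (p + 1) => g) A) (v : Fin (p + 2) → g) :
    (2 : ℤ) • lrD (anchorConnection L) ⇑(MultilinearMap.alternatization f) v =
      altSum (fun u : Fin (p + 2) → g => (2 : ℤ) • L.anchor (u 0) (f fun m => u m.succ) -
        ∑ m : Fin (p + 1), f (Function.update (fun m => u m.succ) m ⁅u 0, u m.succ⁆)) v := by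
  rw [lrD, smul_add, altSum_sub, sub_eq_add_neg]
  congr 1
  · rw [altSum_succ, Finset.smul_sum]
    refine Finset.sum_congr rfl fun i _ => ?_
    rw [smul_comm, alternatization_eq_altSum]
    congr 1
    simp only [altSum, Fin.cons_zero, Fin.cons_succ, map_sum, map_zsmul, Finset.smul_sum,
      anchorConnection]
    exact Finset.sum_congr rfl fun σ _ => smul_comm _ _ _
  · have h := sum_map_update_bracket (MultilinearMap.alternatization f) v
    rw [neg_smul, eq_comm, neg_eq_iff_eq_neg] at h
    rw [h, altSum_succ]
    congr 1
    refine Finset.sum_congr rfl fun i _ => ?_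
    congr 1
    simp only [alternatization_eq_altSum]
    unfold altSum
    rw [Finset.sum_comm]
    refine Finset.sum_congr rfl fun σ _ => ?_
    rw [← Finset.smul_sum]
    congr 1
    rw [← Equiv.sum_comp σ]
    refine Finset.sum_congr rfl fun j _ => ?_
    congr 1
    simp only [Fin.cons_zero, Fin.cons_succ, Function.comp_apply]
    exact Function.update_comp_eq_of_injective (fun m => v (i.succAbove m)) σ.injective j _

/-! ### Words in a two-variable function -/

/-- Extension by zero of a finite tuple to a sequence. -/
def extend {X : Type*} [Zero X] {N : ℕ} (v : Fin N → X) : ℕ → X :=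
  fun i => if h : i < N then v ⟨i, h⟩ else 0

section Extend

variable {X M : Type*} [Zero X] [AddCommGroup M] {N : ℕ}

theorem extend_comp_swap (v : Fin N → X) (i j : Fin N) :
    extend (v ∘ Equiv.swap i j) = extend v ∘ Equiv.swap (i : ℕ) (j : ℕ) := by
  funext m
  simp only [extend, Function.comp_apply, Equiv.swap_apply_def]
  by_cases hm : m < N
  · by_cases h1 : m = i
    · simp [h1]
    · by_cases h2 : m = j
      · subst h2
        simp [h1, Fin.ext_iff]
      · simp [h1, h2, hm, Fin.ext_iff]
  · have h1 : m ≠ i := by omega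
    have h2 : m ≠ j := by omega
    simp [h1, h2, hm]

theorem altSum_swap (F : (ℕ → X) → M) {i j : ℕ} (hi : i < N) (hj : j < N) (hij : i ≠ j)
    (v : Fin N → X) :
    altSum (fun u => F (extend u ∘ Equiv.swap i j)) v = -altSum (fun u => F (extend u)) v := by
  have h := altSum_comp_perm (fun u : Fin N → X => F (extend u))
    (Equiv.swap (⟨i, hi⟩ : Fin N) ⟨j, hj⟩) v
  rw [Equiv.Perm.sign_swap (by simpa [Fin.ext_iff] using hij)] at h
  simpa [extend_comp_swap] using h

/-- Rotation by two of the first `N` entries of a sequence. -/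
def rotateTwo {X : Type*} (N : ℕ) (u : ℕ → X) : ℕ → X :=
  fun i => if i + 2 < N then u (i + 2) else if i < N then u (i + 2 - N) else u i

theorem altSum_rotateTwo (F : (ℕ → X) → M) (v : Fin (N + 2) → X) :
    altSum (fun u => F (rotateTwo (N + 2) (extend u))) v = altSum (fun u => F (extend u)) v := by
  have h := altSum_comp_perm (fun u : Fin (N + 2) → X => F (extend u)) (finRotate (N + 2) ^ 2) v
  have hs : Equiv.Perm.sign (finRotate (N + 2) ^ 2) = 1 := by
    rw [map_pow, Int.units_sq]
  rw [hs, Units.val_one, one_smul] at h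
  rw [← h]
  congr 1
  funext u
  congr 1
  funext i
  simp only [rotateTwo, extend, Function.comp_apply]
  by_cases hi : i < N + 2
  · have hval : (((finRotate (N + 2) ^ 2) ⟨i, hi⟩ : Fin (N + 2)) : ℕ) = (i + 2) % (N + 2) := by
      simp only [pow_two, Equiv.Perm.mul_apply, finRotate_apply, Fin.val_add, Fin.val_one,
        Nat.add_mod_mod, add_assoc, Nat.reduceAdd]
    rw [dif_pos hi, dif_pos hi]
    split_ifs with h1 h2
    · congr 1
      ext
      rw [hval, Nat.mod_eq_of_lt h1]
    · congr 1
      ext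
      rw [hval, Nat.mod_eq_sub_mod (by omega), Nat.mod_eq_of_lt h2]
    · omega
  · rw [dif_neg hi, if_neg (by omega), if_neg hi, dif_neg hi]

end Extend

section Word

variable {X E : Type*} [Ring E]

/-- The product `r (u 0) (u 1) * r (u 2) (u 3) * ⋯` of `n` factors. -/
def word (r : X → X → E) : ℕ → (ℕ → X) → E
  | 0, _ => 1
  | n + 1, u => word r n u * r (u (2 * n)) (u (2 * n + 1))

/-- The sum over all ways of replacing one factor `r` of `word r n` by `s`. -/
def derivWord (r s : X → X → E) : ℕ → (ℕ → X) → E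
  | 0, _ => 0
  | n + 1, u => derivWord r s n u * r (u (2 * n)) (u (2 * n + 1)) +
      word r n u * s (u (2 * n)) (u (2 * n + 1))

theorem word_succ (r : X → X → E) (n : ℕ) (u : ℕ → X) :
    word r (n + 1) u = word r n u * r (u (2 * n)) (u (2 * n + 1)) :=
  rfl

theorem word_congr (r : X → X → E) (n : ℕ) {u u' : ℕ → X} (h : ∀ i < 2 * n, u i = u' i) :
    word r n u = word r n u' := by
  induction n with
  | zero => rfl
  | succ n ih =>
    rw [word, word, ih fun i hi => h i (by omega), h _ (by omega), h _ (by omega)]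

theorem word_succ_left (r : X → X → E) (n : ℕ) (u : ℕ → X) :
    word r (n + 1) u = r (u 0) (u 1) * word r n (fun i => u (i + 2)) := by
  induction n with
  | zero => simp [word]
  | succ n ih =>
    rw [word, ih, word, mul_assoc]
    rfl

variable {M : Type*} [AddCommGroup M] [Zero X]

theorem altSum_word_mul_word (T : E →+ M) (hT : ∀ a b, T (a * b) = T (b * a))
    (r s : X → X → E) (m l : ℕ) {n : ℕ} (hn : n = m + l) (v : Fin (2 * n + 2) → X) :
    altSum (fun w => (fun u => T (word r m u * s (u (2 * m)) (u (2 * m + 1)) *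
        word r l (fun i => u (i + (2 * m + 2))))) (extend w)) v =
      altSum (fun w => (fun u => T (s (u 0) (u 1) * word r n (fun i => u (i + 2)))) (extend w)) v := by
  induction m generalizing l with
  | zero =>
    obtain rfl : n = l := by omega
    simp [word]
  | succ m ih =>
    rw [← ih (l + 1) (by omega), ← altSum_rotateTwo (fun u => T (word r m u *
      s (u (2 * m)) (u (2 * m + 1)) * word r (l + 1) (fun i => u (i + (2 * m + 2)))))]
    congr 1
    funext w
    generalize extend w = u
    subst hn
    have h1 : word r m (rotateTwo (2 * (m + 1 + l) + 2) u) = word r m (fun i => u (i + 2)) :=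
      word_congr r m fun i hi => by rw [rotateTwo, if_pos (by omega)]
    have h2 : word r l (fun i => rotateTwo (2 * (m + 1 + l) + 2) u (i + (2 * m + 2))) =
        word r l (fun i => u (i + (2 * (m + 1) + 2))) :=
      word_congr r l fun i hi => by
        rw [rotateTwo, if_pos (by omega)]
        congr 1
    have h3 : rotateTwo (2 * (m + 1 + l) + 2) u (2 * m) = u (2 * (m + 1)) := by
      rw [rotateTwo, if_pos (by omega)]
      congr 1
    have h4 : rotateTwo (2 * (m + 1 + l) + 2) u (2 * m + 1) = u (2 * (m + 1) + 1) := by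
      rw [rotateTwo, if_pos (by omega)]
      congr 1
    have h5 : rotateTwo (2 * (m + 1 + l) + 2) u (2 * l + (2 * m + 2)) = u 0 := by
      rw [rotateTwo, if_neg (by omega), if_pos (by omega)]
      congr 1
      omega
    have h6 : rotateTwo (2 * (m + 1 + l) + 2) u (2 * l + 1 + (2 * m + 2)) = u 1 := by
      rw [rotateTwo, if_neg (by omega), if_pos (by omega)]
      congr 1
      omega
    simp only [word_succ_left r m u, word_succ r l, h1, h2, h3, h4, h5, h6]
    rw [mul_assoc, mul_assoc, hT]
    simp only [mul_assoc]

/-- Up to cyclic invariance and antisymmetrisation, all terms of `derivWord` agree. -/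
theorem altSum_derivWord (T : E →+ M) (hT : ∀ a b, T (a * b) = T (b * a))
    (r s : X → X → E) (n : ℕ) (v : Fin (2 * n + 2) → X) :
    altSum (fun w => T (derivWord r s (n + 1) (extend w))) v =
      (n + 1) • altSum (fun w =>
        (fun u => T (s (u 0) (u 1) * word r n (fun i => u (i + 2)))) (extend w)) v := by
  have key : ∀ m l, n + 1 = m + l →
      altSum (fun w => (fun u => T (derivWord r s m u *
        word r l (fun i => u (i + 2 * m)))) (extend w)) v =
      m • altSum (fun w =>
        (fun u => T (s (u 0) (u 1) * word r n (fun i => u (i + 2)))) (extend w)) v := by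
    intro m
    induction m with
    | zero => simp [derivWord, altSum]
    | succ m ih =>
      intro l hl
      rw [add_smul, one_smul, ← ih (l + 1) (by omega),
        ← altSum_word_mul_word T hT r s m l (by omega) v, ← altSum_add]
      congr 1
      funext w
      simp only [word_succ_left r l, derivWord, ← map_add, mul_add, add_mul, mul_assoc, zero_add,
        mul_one, add_assoc, add_comm]
  simpa [word] using key (n + 1) 0 rfl

end Word

/-! ### The failure of a word to be covariantly constant -/

section ErrWord

variable {X E : Type*} [Ring E]

/-- The sum over all ways of replacing one factor `r a b` of `word r n` by `e x a b`. -/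
def insertWord (e : X → X → X → E) (r : X → X → E) (x : X) : ℕ → (ℕ → X) → E
  | 0, _ => 0
  | n + 1, u => insertWord e r x n u * r (u (2 * n)) (u (2 * n + 1)) +
      word r n u * e x (u (2 * n)) (u (2 * n + 1))

theorem sum_word_update (r : X → X → E) (c : X → X) (n : ℕ) (u : ℕ → X) :
    ∑ m ∈ Finset.range (2 * (n + 1)), word r (n + 1) (Function.update u m (c (u m))) =
      (∑ m ∈ Finset.range (2 * n), word r n (Function.update u m (c (u m)))) *
          r (u (2 * n)) (u (2 * n + 1)) +
        word r n u * (r (c (u (2 * n))) (u (2 * n + 1)) + r (u (2 * n)) (c (u (2 * n + 1)))) := by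
  have h1 : word r n (Function.update u (2 * n) (c (u (2 * n)))) = word r n u :=
    word_congr r n fun i hi => Function.update_of_ne (by omega) _ _
  have h2 : word r n (Function.update u (2 * n + 1) (c (u (2 * n + 1)))) = word r n u :=
    word_congr r n fun i hi => Function.update_of_ne (by omega) _ _
  rw [show 2 * (n + 1) = 2 * n + 1 + 1 by ring, Finset.sum_range_succ, Finset.sum_range_succ,
    word_succ, word_succ, h1, h2, Function.update_self, Function.update_self,
    Function.update_of_ne (by omega), Function.update_of_ne (by omega), mul_add, add_assoc,
    Finset.sum_mul]
  congr 1
  refine Finset.sum_congr rfl fun m hm => ?_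
  rw [Finset.mem_range] at hm
  rw [word_succ, Function.update_of_ne (by omega), Function.update_of_ne (by omega)]

theorem two_smul_sub_sum_word_update (r : X → X → E) (d : E → E) (c : X → X) (x : X)
    (e : X → X → X → E) (hd : ∀ a b, d (a * b) = d a * b + a * d b)
    (he : ∀ a b, e x a b = (2 : ℤ) • d (r a b) - r (c a) b - r a (c b)) (n : ℕ) (u : ℕ → X) :
    (2 : ℤ) • d (word r n u) -
        ∑ m ∈ Finset.range (2 * n), word r n (Function.update u m (c (u m))) =
      insertWord e r x n u := by
  induction n with
  | zero =>
    have : d 1 = 0 := by simpa using hd 1 1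
    simp [word, insertWord, this]
  | succ n ih =>
    rw [sum_word_update, word_succ, insertWord, ← ih, he, hd, two_smul, two_smul, two_smul]
    noncomm_ring

theorem altSum_insertWord [Zero X] (T : E →+ A) (k : Type*) [Field k] [CharZero k] [Algebra k A]
    (e : X → X → X → E) (r : X → X → E) (p : X → E)
    (he : ∀ x a b, e x a b + e a b x + e b x a = 0) {N : ℕ} (n : ℕ) (hN : 2 * n + 2 ≤ N)
    (h : (ℕ → X) → E) (hh : ∀ u u' : ℕ → X, (∀ i, 2 * n + 2 ≤ i → u i = u' i) → h u = h u')
    (v : Fin N → X) :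
    altSum (fun w => (fun u => T (p (u 1) * insertWord e r (u 0) n (fun i => u (i + 2)) * h u))
      (extend w)) v = 0 := by
  induction n generalizing h with
  | zero => simp [insertWord, altSum]
  | succ n ih =>
    have h1 := ih (by omega) (fun u => r (u (2 * n + 2)) (u (2 * n + 1 + 2)) * h u)
      (fun u u' hu => by
        simp only [hu (2 * n + 2) (by omega), hu (2 * n + 1 + 2) (by omega)]
        rw [hh u u' fun i hi => hu i (by omega)])
    let G : (ℕ → X) → A := fun u => T (p (u 1) * (word r n (fun i => u (i + 2)) *
      e (u 0) (u (2 * n + 2)) (u (2 * n + 1 + 2))) * h u)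
    have hG : ∀ u : ℕ → X, T (p (u 1) * insertWord e r (u 0) (n + 1) (fun i => u (i + 2)) * h u) =
        T (p (u 1) * insertWord e r (u 0) n (fun i => u (i + 2)) *
          (r (u (2 * n + 2)) (u (2 * n + 1 + 2)) * h u)) + G u := fun u => by
      simp only [G, insertWord, ← map_add, mul_add, add_mul, mul_assoc]
    simp only [hG]
    rw [altSum_add, h1, zero_add]
    let a := 2 * n + 2
    let b := 2 * n + 1 + 2
    let c : (ℕ → X) → ℕ → X := fun u => (u ∘ Equiv.swap 0 a) ∘ Equiv.swap a b
    have hc0 : ∀ u, c u 0 = u a := fun u => by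
      simp [c, a, b, Equiv.swap_apply_def]
    have hca : ∀ u, c u a = u b := fun u => by
      simp [c, a, b, Equiv.swap_apply_def]
    have hcb : ∀ u, c u b = u 0 := fun u => by
      simp [c, a, b, Equiv.swap_apply_def]
    have hci : ∀ u i, i ≠ 0 → i ≠ a → i ≠ b → c u i = u i := fun u i h0 ha hb => by
      simp [c, Equiv.swap_apply_of_ne_of_ne, h0, ha, hb]
    have hcalt : ∀ F : (ℕ → X) → A,
        altSum (fun w : Fin N → X => F (c (extend w))) v = altSum (fun w => F (extend w)) v := by
      intro F
      have := altSum_swap (fun u => F (u ∘ Equiv.swap a b)) (i := 0) (j := a) (N := N)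
        (by omega) (by omega) (by omega) v
      rw [altSum_swap F (by omega) (by omega) (by omega) v, neg_neg] at this
      exact this
    have hGc : ∀ u, G u + G (c u) + G (c (c u)) = 0 := by
      intro u
      have e1 : ∀ u, word r n (fun i => c u (i + 2)) = word r n (fun i => u (i + 2)) := fun u =>
        word_congr r n fun i hi => hci u _ (by omega) (by omega) (by omega)
      have e2 : ∀ u, h (c u) = h u := fun u =>
        hh _ _ fun i hi => hci u _ (by omega) (by omega) (by omega)
      have e3 : ∀ u, c u 1 = u 1 := fun u => hci u _ (by omega) (by omega) (by omega)
      have hGu : ∀ u, G u = T (p (u 1) * (word r n (fun i => u (i + 2)) *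
        e (u 0) (u a) (u b)) * h u) := fun u => rfl
      rw [hGu, hGu, hGu]
      simp only [e1, e2, e3, hc0, hca, hcb]
      rw [← map_add, ← map_add, ← add_mul, ← add_mul, ← mul_add, ← mul_add, ← mul_add, ← mul_add,
        he]
      simp
    have hsum : altSum (fun w : Fin N → X => G (extend w) + G (c (extend w)) +
        G (c (c (extend w)))) v = 0 := by
      simp [hGc, altSum]
    rw [altSum_add, altSum_add, hcalt, hcalt (fun u => G (c u)), hcalt] at hsum
    have h3 : (3 : k) • altSum (fun w : Fin N → X => G (extend w)) v = 0 := by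
      rw [← hsum, show (3 : k) = 1 + 1 + 1 by norm_num, add_smul, add_smul, one_smul]
    exact (smul_eq_zero.mp h3).resolve_left (by norm_num)

end ErrWord

/-! ### Curvature as an `A`-bilinear form -/

section Curvature

theorem LRConnection.conn_neg (D : LRConnection L W) (x : g) : D.conn (-x) = -D.conn x :=
  map_neg (AddMonoidHom.mk' D.conn D.conn_add) x

theorem LRConnection.conn_sub (D : LRConnection L W) (x y : g) :
    D.conn (x - y) = D.conn x - D.conn y :=
  map_sub (AddMonoidHom.mk' D.conn D.conn_add) x y

theorem LieRinehart.smul_bracket (L : LieRinehart k A g) (a : A) (x y : g) :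
    ⁅a • x, y⁆ = a • ⁅x, y⁆ - L.anchor y a • x := by
  rw [← lie_skew, L.bracket_smul, ← lie_skew x y, smul_neg]
  abel

theorem curvK_apply (D : LRConnection L W) (x y : g) (w : W) :
    curvK D x y w = D.conn x (D.conn y w) - D.conn y (D.conn x w) - D.conn ⁅x, y⁆ w := by
  simp [curvK, Ring.lie_def]

theorem curvK_skew (D : LRConnection L W) (x y : g) (w : W) : curvK D y x w = -curvK D x y w := by
  rw [curvK_apply, curvK_apply, ← lie_skew x y, D.conn_neg, LinearMap.neg_apply]
  abel

theorem curvK_smul_left (D : LRConnection L W) (a : A) (x y : g) (w : W) :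
    curvK D (a • x) y w = a • curvK D x y w := by
  rw [curvK_apply, curvK_apply, L.smul_bracket, D.conn_sub, LinearMap.sub_apply]
  simp only [D.conn_smul, D.leibniz, smul_sub]
  abel

theorem curvK_add_left (D : LRConnection L W) (x x' y : g) (w : W) :
    curvK D (x + x') y w = curvK D x y w + curvK D x' y w := by
  simp only [curvK_apply, D.conn_add, add_lie, LinearMap.add_apply, map_add]
  abel

/-- The curvature of a connection, as an `A`-bilinear form with values in `End_A(W)`. -/
noncomputable def curv (D : LRConnection L W) : g →ₗ[A] g →ₗ[A] Module.End A W :=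
  LinearMap.mk₂ A
    (fun x y =>
      { toFun := curvK D x y
        map_add' := map_add _
        map_smul' := fun a w => by
          simp only [curvK_apply, D.leibniz, map_add, L.anchor_bracket, Ring.lie_def,
            LinearMap.sub_apply, Module.End.mul_apply, sub_smul, smul_sub, RingHom.id_apply]
          abel })
    (fun x x' y => LinearMap.ext fun w => curvK_add_left D x x' y w)
    (fun a x y => LinearMap.ext fun w => curvK_smul_left D a x y w)
    (fun x y y' => LinearMap.ext fun w => by
      change curvK D x (y + y') w = curvK D x y w + curvK D x y' w
      rw [curvK_skew, curvK_add_left, curvK_skew D x y, curvK_skew D x y', neg_add, neg_neg,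
        neg_neg])
    (fun a x y => LinearMap.ext fun w => by
      change curvK D x (a • y) w = a • curvK D x y w
      rw [curvK_skew, curvK_smul_left, curvK_skew D x y, smul_neg, neg_neg])

theorem curv_apply (D : LRConnection L W) (x y : g) (w : W) :
    curv D x y w = D.conn x (D.conn y w) - D.conn y (D.conn x w) - D.conn ⁅x, y⁆ w :=
  curvK_apply D x y w

theorem adAct_apply (D : LRConnection L W) (x : g) (φ : Module.End A W) (w : W) :
    adAct D x φ w = D.conn x (φ w) - φ (D.conn x w) :=
  rfl

theorem adAct_mul (D : LRConnection L W) (x : g) (φ ψ : Module.End A W) :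
    adAct D x (φ * ψ) = (adAct D x φ : Module.End A W) * ψ + φ * (adAct D x ψ : Module.End A W) := by
  ext w
  simp [adAct_apply]

/-- The second Bianchi identity. -/
theorem bianchi (D : LRConnection L W) (e : g → g → g → Module.End A W)
    (he : ∀ x a b, e x a b =
      (2 : ℤ) • (adAct D x (curv D a b) : Module.End A W) - curv D ⁅x, a⁆ b - curv D a ⁅x, b⁆)
    (x a b : g) : e x a b + e a b x + e b x a = 0 := by
  ext w
  have hconn : D.conn ⁅b, ⁅x, a⁆⁆ w = -(D.conn ⁅x, ⁅a, b⁆⁆ w) - D.conn ⁅a, ⁅b, x⁆⁆ w := by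
    have : ⁅b, ⁅x, a⁆⁆ = -⁅x, ⁅a, b⁆⁆ - ⁅a, ⁅b, x⁆⁆ := by
      rw [← sub_eq_zero, ← lie_jacobi b x a]
      abel
    rw [this, D.conn_sub, D.conn_neg]
    rfl
  simp only [he, LinearMap.add_apply, LinearMap.sub_apply, adAct_apply,
    curv_apply, map_sub, LinearMap.zero_apply, two_smul]
  rw [← lie_skew a x, ← lie_skew b a, ← lie_skew x b]
  rw [← lie_skew ⁅x, a⁆ b, ← lie_skew ⁅a, b⁆ x, ← lie_skew ⁅b, x⁆ a]
  simp only [lie_neg, D.conn_neg, LinearMap.neg_apply, map_neg, hconn]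
  abel

theorem anchor_trace [Module.Finite A W] [Module.Free A W] (D : LRConnection L W) (x : g)
    (φ : Module.End A W) :
    L.anchor x (LinearMap.trace A W φ) = LinearMap.trace A W (adAct D x φ) := by
  classical
  let b := Module.Free.chooseBasis A W
  have hexp : ∀ w : W, D.conn x w =
      ∑ i, (b.repr w i • D.conn x (b i) + L.anchor x (b.repr w i) • b i) := fun w => by
    conv_lhs => rw [← b.sum_repr w]
    rw [map_sum]
    simp only [D.leibniz]
  have hφ : ∀ w : W, φ w = ∑ i, b.repr w i • φ (b i) := fun w => by
    conv_lhs => rw [← b.sum_repr w]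
    simp only [map_sum, map_smul]
  rw [LinearMap.trace_eq_matrix_trace A b, LinearMap.trace_eq_matrix_trace A b, Matrix.trace,
    Matrix.trace, map_sum]
  simp only [Matrix.diag_apply, LinearMap.toMatrix_apply, adAct_apply, map_sub,
    Finsupp.sub_apply, Finset.sum_sub_distrib]
  have h1 : ∀ j, b.repr (D.conn x (φ (b j))) j =
      ∑ i, b.repr (φ (b j)) i * b.repr (D.conn x (b i)) j + L.anchor x (b.repr (φ (b j)) j) :=
    fun j => by
      rw [hexp]
      simp [Finset.sum_add_distrib, Finsupp.single_apply]
  have h2 : ∀ j, b.repr (φ (D.conn x (b j))) j =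
      ∑ i, b.repr (D.conn x (b j)) i * b.repr (φ (b i)) j := fun j => by
    rw [hφ]
    simp
  simp only [h1, h2, Finset.sum_add_distrib]
  rw [Finset.sum_comm, eq_sub_iff_add_eq, add_comm]
  congr 1
  exact Finset.sum_congr rfl fun i _ => Finset.sum_congr rfl fun j _ => mul_comm _ _

end Curvature

/-! ### The affine path between two connections -/

section Interpolation

/-- The difference of two connections, as an `A`-linear form with values in `End_A(W)`. -/
noncomputable def diffConn (D0 D1 : LRConnection L W) : g →ₗ[A] Module.End A W where
  toFun x :=
    { toFun := fun w => D1.conn x w - D0.conn x w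
      map_add' := fun v w => by
        simp only [map_add]
        abel
      map_smul' := fun a w => by
        simp only [LRConnection.leibniz, RingHom.id_apply, smul_sub]
        abel }
  map_add' x y := by
    ext w
    simp only [LRConnection.conn_add, LinearMap.add_apply, LinearMap.coe_mk, AddHom.coe_mk]
    abel
  map_smul' a x := by
    ext w
    simp only [LRConnection.conn_smul, LinearMap.smul_apply, LinearMap.coe_mk, AddHom.coe_mk,
      RingHom.id_apply, smul_sub]

theorem diffConn_apply (D0 D1 : LRConnection L W) (x : g) (w : W) :
    diffConn D0 D1 x w = D1.conn x w - D0.conn x w :=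
  rfl

/-- The connection `(1 - t) ∇₀ + t ∇₁`. -/
noncomputable def interp (D0 D1 : LRConnection L W) (t : k) : LRConnection L W where
  conn x := D0.conn x + t • (D1.conn x - D0.conn x)
  conn_add x y := by
    simp only [LRConnection.conn_add, smul_sub, smul_add]
    abel
  conn_smul a x w := by
    simp only [LinearMap.add_apply, LinearMap.sub_apply, LinearMap.smul_apply,
      LRConnection.conn_smul, smul_add, smul_sub, smul_comm t a]
  leibniz x a w := by
    simp only [LinearMap.add_apply, LinearMap.sub_apply, LinearMap.smul_apply,
      LRConnection.leibniz, smul_add, smul_sub, smul_comm t a]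
    abel

theorem interp_conn (D0 D1 : LRConnection L W) (t : k) (x : g) (w : W) :
    (interp D0 D1 t).conn x w = D0.conn x w + t • diffConn D0 D1 x w :=
  rfl

/-- The derivative of the curvature of a connection in the direction of `θ`. -/
noncomputable def curvDeriv (D : LRConnection L W) (θ : g →ₗ[A] Module.End A W) (x y : g) :
    Module.End A W :=
  (adAct D x (θ y) : Module.End A W) - adAct D y (θ x) - θ ⁅x, y⁆

theorem curvDeriv_apply (D : LRConnection L W) (θ : g →ₗ[A] Module.End A W) (x y : g) (w : W) :
    curvDeriv D θ x y w = D.conn x (θ y w) - θ y (D.conn x w) -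
      (D.conn y (θ x w) - θ x (D.conn y w)) - θ ⁅x, y⁆ w :=
  rfl

theorem curv_interp (D0 D1 : LRConnection L W) (t : k) (x y : g) :
    curv (interp D0 D1 t) x y = curv D0 x y + t • curvDeriv D0 (diffConn D0 D1) x y +
      t ^ 2 • (diffConn D0 D1 x * diffConn D0 D1 y - diffConn D0 D1 y * diffConn D0 D1 x) := by
  ext w
  simp only [curv_apply, interp_conn, LinearMap.add_apply, LinearMap.sub_apply,
    LinearMap.smul_apply, curvDeriv_apply, Module.End.mul_apply, map_add, map_smul, smul_sub,
    smul_add, pow_two, mul_smul]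
  abel

theorem curvDeriv_interp (D0 D1 : LRConnection L W) (t : k) (x y : g) :
    curvDeriv (interp D0 D1 t) (diffConn D0 D1) x y =
      curvDeriv D0 (diffConn D0 D1) x y + (2 * t) •
      (diffConn D0 D1 x * diffConn D0 D1 y - diffConn D0 D1 y * diffConn D0 D1 x) := by
  ext w
  simp only [interp_conn, LinearMap.add_apply, LinearMap.sub_apply,
    LinearMap.smul_apply, curvDeriv_apply, Module.End.mul_apply, map_add, smul_sub,
    mul_smul, two_smul, LinearMap.map_smul_of_tower]
  abel

theorem curv_interp_zero (D0 D1 : LRConnection L W) : curv (interp D0 D1 0) = curv D0 := by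
  ext x y w
  simp [curv_interp]

theorem curv_interp_one (D0 D1 : LRConnection L W) : curv (interp D0 D1 1) = curv D1 := by
  ext x y w
  simp [curv_apply, interp_conn, diffConn_apply]

end Interpolation

/-! ### The transgression form -/

section Transgression

theorem extend_update {X : Type*} [Zero X] {N : ℕ} [DecidableEq (Fin N)] (w : Fin N → X)
    (m : Fin N) (x : X) : extend (Function.update w m x) = Function.update (extend w) m x := by
  funext i
  by_cases hi : i < N
  · by_cases him : i = m
    · subst him
      simp [extend]
    · have : (⟨i, hi⟩ : Fin N) ≠ m := fun h => him (by rw [← h])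
      simp [extend, hi, him, this]
  · have : i ≠ m := by omega
    simp [extend, hi, this]

variable {E : Type*} [Ring E] [Algebra A E]

theorem exists_linearMap_word_update (r : g →ₗ[A] g →ₗ[A] E) (n : ℕ) (u : ℕ → g) (m : ℕ)
    (hm : m < 2 * n) :
    ∃ l : g →ₗ[A] E, ∀ x, word (fun a b => r a b) n (Function.update u m x) = l x := by
  induction n with
  | zero => omega
  | succ n ih =>
    rcases lt_trichotomy m (2 * n) with h | h | h
    · obtain ⟨l, hl⟩ := ih h
      refine ⟨LinearMap.mulRight A (r (u (2 * n)) (u (2 * n + 1))) ∘ₗ l, fun x => ?_⟩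
      rw [word_succ, hl, Function.update_of_ne (by omega), Function.update_of_ne (by omega)]
      rfl
    · subst h
      refine ⟨LinearMap.mulLeft A (word (fun a b => r a b) n u) ∘ₗ r.flip (u (2 * n + 1)),
        fun x => ?_⟩
      rw [word_succ, Function.update_self, Function.update_of_ne (by omega),
        word_congr _ _ fun i hi => Function.update_of_ne (show i ≠ 2 * n by omega) _ _]
      rfl
    · obtain rfl : m = 2 * n + 1 := by omega
      refine ⟨LinearMap.mulLeft A (word (fun a b => r a b) n u) ∘ₗ r (u (2 * n)), fun x => ?_⟩
      rw [word_succ, Function.update_self, Function.update_of_ne (by omega),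
        word_congr _ _ fun i hi => Function.update_of_ne (show i ≠ 2 * n + 1 by omega) _ _]
      rfl

theorem exists_linearMap_mul_word_update (θ : g →ₗ[A] E) (r : g →ₗ[A] g →ₗ[A] E) (n : ℕ)
    (u : ℕ → g) (m : ℕ) (hm : m < 2 * n + 1) :
    ∃ l : g →ₗ[A] E, ∀ x, θ (Function.update u m x 0) *
      word (fun a b => r a b) n (fun i => Function.update u m x (i + 1)) = l x := by
  cases m with
  | zero =>
    refine ⟨LinearMap.mulRight A (word (fun a b => r a b) n (fun i => u (i + 1))) ∘ₗ θ,
      fun x => ?_⟩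
    simp
  | succ m =>
    obtain ⟨l, hl⟩ := exists_linearMap_word_update r n (fun i => u (i + 1)) m (by omega)
    refine ⟨LinearMap.mulLeft A (θ (u 0)) ∘ₗ l, fun x => ?_⟩
    have : (fun i => Function.update u (m + 1) x (i + 1)) =
        Function.update (fun i => u (i + 1)) m x := by
      funext i
      simp [Function.update_apply]
    rw [this, hl]
    simp

/-- The multilinear form `T (θ ∧ r ∧ ⋯ ∧ r)`, before antisymmetrisation. -/
def transgression (T : E →ₗ[A] A) (θ : g →ₗ[A] E) (r : g →ₗ[A] g →ₗ[A] E) (n : ℕ) :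
    MultilinearMap A (fun _ : Fin (2 * n + 1) => g) A where
  toFun w := T (θ (extend w 0) * word (fun a b => r a b) n (fun i => extend w (i + 1)))
  map_update_add' w m x y := by
    obtain ⟨l, hl⟩ := exists_linearMap_mul_word_update θ r n (extend w) m m.2
    simp only [extend_update, hl, map_add]
  map_update_smul' w m c x := by
    obtain ⟨l, hl⟩ := exists_linearMap_mul_word_update θ r n (extend w) m m.2
    simp only [extend_update, hl, map_smul]

theorem transgression_apply (T : E →ₗ[A] A) (θ : g →ₗ[A] E) (r : g →ₗ[A] g →ₗ[A] E) (n : ℕ)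
    (w : Fin (2 * n + 1) → g) : transgression T θ r n w =
      T (θ (extend w 0) * word (fun a b => r a b) n (fun i => extend w (i + 1))) :=
  rfl

end Transgression

section TransgressionDifferential

theorem altSum_add_altSum_swap {M : Type*} [AddCommGroup M] {N : ℕ} (F : (ℕ → g) → M)
    (v : Fin (N + 2) → g) :
    altSum (fun w => F (extend w)) v + altSum (fun w => F (extend w ∘ Equiv.swap 0 1)) v = 0 := by
  rw [altSum_swap F (by omega) (by omega) (by omega), add_neg_cancel]

theorem two_smul_lrD_transgression [Module.Finite A W] [Module.Free A W] (D : LRConnection L W)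
    (θ : g →ₗ[A] Module.End A W) (n : ℕ) (v : Fin (2 * n + 2) → g) :
    (2 : ℤ) • lrD (anchorConnection L) ⇑(MultilinearMap.alternatization
        (transgression (LinearMap.trace A W) θ (curv D) n)) v =
      altSum (fun w => (fun u => LinearMap.trace A W (curvDeriv D θ (u 0) (u 1) *
        word (fun a b => curv D a b) n (fun i => u (i + 2)))) (extend w)) v := by
  set r : g → g → Module.End A W := fun a b => curv D a b with hr
  let e : g → g → g → Module.End A W := fun x a b =>
    (2 : ℤ) • (adAct D x (curv D a b) : Module.End A W) - curv D ⁅x, a⁆ b - curv D a ⁅x, b⁆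
  have hins := altSum_insertWord (LinearMap.trace A W).toAddMonoidHom k e r (fun x => θ x)
    (bianchi D e fun _ _ _ => rfl) n le_rfl (fun _ => 1) (fun _ _ _ => rfl) v
  let F : (ℕ → g) → A := fun u => LinearMap.trace A W ((adAct D (u 0) (θ (u 1)) : Module.End A W) *
    word r n (fun i => u (i + 2)))
  let G : (ℕ → g) → A := fun u => LinearMap.trace A W (θ ⁅u 0, u 1⁆ *
    word r n (fun i => u (i + 2)))
  have hF := altSum_add_altSum_swap F v
  have hs : ∀ u : ℕ → g, LinearMap.trace A W (curvDeriv D θ (u 0) (u 1) *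
      word r n (fun i => u (i + 2))) = F u - F (u ∘ Equiv.swap 0 1) - G u := fun u => by
    have h1 : (fun i => (u ∘ Equiv.swap 0 1) (i + 2)) = fun i => u (i + 2) := by
      funext i
      rw [Function.comp_apply, Equiv.swap_apply_of_ne_of_ne (by omega) (by omega)]
    change _ = _ - LinearMap.trace A W (_ * word r n (fun i => (u ∘ Equiv.swap 0 1) (i + 2))) - _
    rw [h1, Function.comp_apply, Function.comp_apply, Equiv.swap_apply_left,
      Equiv.swap_apply_right, ← map_sub, ← map_sub, ← sub_mul, ← sub_mul]
    rfl
  simp only [hs]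
  rw [altSum_sub, altSum_sub, eq_neg_of_add_eq_zero_right hF, sub_neg_eq_add, ← altSum_add,
    ← altSum_sub, two_smul_lrD_alternatization, ← sub_eq_zero, ← altSum_sub]
  refine Eq.trans ?_ hins
  congr 1
  funext w
  have hw : extend (fun m : Fin (2 * n + 1) => w m.succ) = fun i => extend w (i + 1) := by
    funext i
    simp [extend, Fin.succ]
  have hsucc : ∀ m : Fin (2 * n + 1), w m.succ = extend w (m + 1) := fun m => by
    simp only [extend, Fin.succ, dif_pos (Nat.succ_lt_succ m.2)]
  have h0 : w 0 = extend w 0 := by simp [extend]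
  simp only [transgression_apply, extend_update, hw, ← hr]
  simp only [hsucc, h0]
  generalize extend w = u
  have hword := two_smul_sub_sum_word_update r (fun φ => (adAct D (u 0) φ : Module.End A W))
    (fun y => ⁅u 0, y⁆) (u 0) e (adAct_mul D (u 0)) (fun _ _ => rfl) n (fun i => u (i + 2))
  have hupd : ∀ m x, (fun i => Function.update (fun i => u (i + 1)) (m + 1) x (i + 1)) =
      Function.update (fun i => u (i + 2)) m x := fun m x => by
    funext i
    simp [Function.update_apply]
  have hupd0 : ∀ x, (fun i => Function.update (fun i => u (i + 1)) 0 x (i + 1)) =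
      fun i => u (i + 2) := fun x => by
    funext i
    simp
  rw [Fin.sum_univ_succ, anchor_trace D, adAct_mul, ← hword]
  simp only [Fin.val_zero, Fin.val_succ, hupd, hupd0, Function.update_self, zero_add,
    Function.update_of_ne (Nat.succ_ne_zero _).symm]
  rw [Fin.sum_univ_eq_sum_range (fun m => LinearMap.trace A W (θ (u 1) *
    word r n (Function.update (fun i => u (i + 2)) m ⁅u 0, u (m + 1 + 1)⁆)))]
  simp only [LinearMap.toAddMonoidHom_coe, mul_one, mul_sub, Finset.mul_sum, map_sub, map_sum,
    map_add, mul_smul_comm, map_zsmul, smul_add, F, G]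
  rw [two_smul _ (LinearMap.trace A W (_ * word r n _))]
  abel

end TransgressionDifferential

section PowC

theorem two_pow_smul_powC (R : (Fin 2 → g) → Module.End A W) (r : g → g → Module.End A W)
    (hr : ∀ x y, r y x = -r x y) (hR : ∀ u, R u = r (u 0) (u 1)) (n : ℕ) (v : Fin (2 * n) → g) :
    (2 ^ n : ℤ) • (powC R n v : Module.End A W) = altSum (fun w => word r n (extend w)) v := by
  have h2 : ∀ u : Fin 2 → g, altSum (fun w => r (w 0) (w 1)) u = (2 : ℤ) • R u := fun u => by
    have huniv : (Finset.univ : Finset (Equiv.Perm (Fin 2))) = {1, Equiv.swap 0 1} := by decide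
    rw [altSum, huniv, Finset.sum_pair (by decide)]
    simp [hR, hr (u 0), two_smul]
  induction n with
  | zero => simp [powC, altSum, word]; rfl
  | succ n ih =>
    have hw : (2 ^ (n + 1) : ℤ) • (powC R (n + 1) v : Module.End A W) =
        wedge (altSum (fun w : Fin (2 * n) → g => word r n (extend w)))
          (altSum fun w : Fin 2 → g => r (w 0) (w 1))
          (fun a b => AddMonoidHom.mul a b) v := by
      have h3 : altSum (fun w : Fin (2 * n) → g => word r n (extend w)) =
        fun u => (2 ^ n : ℤ) • (powC R n u : Module.End A W) := funext fun u => (ih u).symm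
      have h4 : altSum (fun w : Fin 2 → g => r (w 0) (w 1)) = fun u => (2 : ℤ) • R u :=
        funext h2
      rw [h3, h4]
      change (2 ^ (n + 1) : ℤ) • wedge (powC R n) R (fun f1 f2 => f1 ∘ₗ f2) v = _
      rw [wedge, wedge, Finset.smul_sum]
      refine Finset.sum_congr rfl fun σ _ => ?_
      split_ifs
      · rw [smul_comm]
        congr 1
        simp only [map_zsmul, AddMonoidHom.coe_smul, Pi.smul_apply, smul_smul]
        rw [← pow_succ']
        rfl
      · simp
    rw [hw, wedge_altSum]
    congr 1
    funext u
    have h1 : word r n (extend fun i : Fin (2 * n) => u (Fin.castAdd 2 i)) =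
        word r n (extend u) :=
      word_congr r n fun i hi => by
        rw [extend, extend, dif_pos hi, dif_pos (by omega)]
        rfl
    have h2 : extend u (2 * n) = u (Fin.natAdd (2 * n) 0) := dif_pos (by omega)
    have h3 : extend u (2 * n + 1) = u (Fin.natAdd (2 * n) 1) := dif_pos (by omega)
    rw [word_succ, h2, h3, ← h1]
    rfl

end PowC

/-! ### Integration along the path by exact quadrature -/

section Quadrature

open Polynomial

theorem exists_quadrature (k : Type*) [Field k] [CharZero k] (d : ℕ) :
    ∃ c t : Fin d → k, ∀ j : ℕ, j < d → (∑ i, c i * t i ^ j) * (j + 1) = 1 := by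
  let t : Fin d → k := fun i => ((i : ℕ) : k)
  have ht : Function.Injective t := fun i j h => Fin.ext (Nat.cast_injective h)
  have hdet : IsUnit (Matrix.vandermonde t).det :=
    (Matrix.det_vandermonde_ne_zero_iff.mpr ht).isUnit
  let b : Fin d → k := fun j => ((j : ℕ) + 1 : k)⁻¹
  refine ⟨Matrix.vecMul b (Matrix.vandermonde t)⁻¹, t, fun j hj => ?_⟩
  have h : Matrix.vecMul (Matrix.vecMul b (Matrix.vandermonde t)⁻¹) (Matrix.vandermonde t) = b := by
    rw [Matrix.vecMul_vecMul, Matrix.nonsing_inv_mul _ hdet, Matrix.vecMul_one]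
  have hb : ∑ i, Matrix.vecMul b (Matrix.vandermonde t)⁻¹ i * t i ^ j = ((j : k) + 1)⁻¹ :=
    congrFun h ⟨j, hj⟩
  rw [hb, inv_mul_cancel₀ (Nat.cast_add_one_ne_zero j)]

variable {E : Type*} [Ring E] [Algebra k E]

theorem eval_one_sub_eval_zero {d : ℕ} {c t : Fin d → k}
    (hc : ∀ j : ℕ, j < d → (∑ i, c i * t i ^ j) * (j + 1) = 1) (p : E[X]) (hp : p.natDegree ≤ d) :
    p.eval 1 - p.eval 0 = ∑ i, c i • p.derivative.eval (algebraMap k E (t i)) := by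
  have h1 : p.eval 1 - p.eval 0 = ∑ j ∈ Finset.range d, p.coeff (j + 1) := by
    rw [eval_eq_sum_range' (Nat.lt_succ_of_le hp), Finset.sum_range_succ', ← coeff_zero_eq_eval_zero]
    simp
  have h2 : ∀ x : E, p.derivative.eval x =
      ∑ j ∈ Finset.range d, p.coeff (j + 1) * (j + 1) * x ^ j := fun x => by
    rw [eval_eq_sum_range' (n := d + 1)
      (Nat.lt_succ_of_le ((natDegree_derivative_le p).trans (by omega))), Finset.sum_range_succ,
      coeff_derivative, coeff_eq_zero_of_natDegree_lt (Nat.lt_succ_of_le hp)]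
    simp [coeff_derivative]
  simp only [h1, h2, Finset.smul_sum]
  rw [Finset.sum_comm]
  refine Finset.sum_congr rfl fun j hj => ?_
  have h3 : ∀ i, c i • (p.coeff (j + 1) * (j + 1) * algebraMap k E (t i) ^ j) =
      (c i * t i ^ j * (j + 1)) • p.coeff (j + 1) := fun i => by
    rw [show (j : E) + 1 = algebraMap k E (j + 1) by simp, ← map_pow, mul_assoc, ← map_mul,
      ← Algebra.commutes, ← Algebra.smul_def, smul_smul]
    congr 1
    ring
  simp only [h3]
  rw [← Finset.sum_smul, ← Finset.sum_mul, hc j (Finset.mem_range.mp hj), one_smul]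

theorem exists_polynomial_word {X : Type*} (a b c : X → X → E) (n : ℕ) (u : ℕ → X) :
    ∃ p : E[X], p.natDegree ≤ 2 * n ∧ ∀ t : k,
      word (fun x y => a x y + t • b x y + t ^ 2 • c x y) n u = p.eval (algebraMap k E t) ∧
      derivWord (fun x y => a x y + t • b x y + t ^ 2 • c x y)
        (fun x y => b x y + (2 * t) • c x y) n u = p.derivative.eval (algebraMap k E t) := by
  have hmul : ∀ (p q : E[X]) (t : k),
      (p * q).eval (algebraMap k E t) = p.eval (algebraMap k E t) * q.eval (algebraMap k E t) :=
    fun p q t => eval₂_mul_noncomm _ _ fun _ => (Algebra.commutes t _).symm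
  induction n with
  | zero => exact ⟨1, by simp, fun t => by simp [word, derivWord]⟩
  | succ n ih =>
    obtain ⟨p, hp, h⟩ := ih
    let x := u (2 * n)
    let y := u (2 * n + 1)
    let q : E[X] := C (a x y) + C (b x y) * Polynomial.X + C (c x y) * Polynomial.X ^ 2
    have hq : q.natDegree ≤ 2 := by
      dsimp only [q]
      compute_degree
    have hscal : ∀ (e : E) (t : k), e * algebraMap k E t = t • e := fun e t => by
      rw [← Algebra.commutes, Algebra.smul_def]
    have hq0 : ∀ t : k, q.eval (algebraMap k E t) = a x y + t • b x y + t ^ 2 • c x y := fun t => by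
      simp [q, ← map_pow, hscal]
    have hq1 : ∀ t : k, q.derivative.eval (algebraMap k E t) = b x y + (2 * t) • c x y :=
      fun t => by
        simp [q, hscal, two_mul, mul_add, add_smul]
    refine ⟨p * q, natDegree_mul_le.trans (by omega), fun t => ⟨?_, ?_⟩⟩
    · rw [hmul, hq0, ← (h t).1]
      rfl
    · rw [derivative_mul, eval_add, hmul, hmul, hq0, hq1, ← (h t).1, ← (h t).2]
      rfl

theorem word_sub_word {X : Type*} {n : ℕ} {c t : Fin (2 * n) → k}
    (hc : ∀ j : ℕ, j < 2 * n → (∑ i, c i * t i ^ j) * (j + 1) = 1)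
    (r s : k → X → X → E) (r₀ r₁ r₂ : X → X → E)
    (hr : ∀ t x y, r t x y = r₀ x y + t • r₁ x y + t ^ 2 • r₂ x y)
    (hs : ∀ t x y, s t x y = r₁ x y + (2 * t) • r₂ x y) (u : ℕ → X) :
    word (r 1) n u - word (r 0) n u = ∑ i, c i • derivWord (r (t i)) (s (t i)) n u := by
  obtain rfl : r = fun t x y => r₀ x y + t • r₁ x y + t ^ 2 • r₂ x y := by
    funext t x y
    exact hr t x y
  obtain rfl : s = fun t x y => r₁ x y + (2 * t) • r₂ x y := by
    funext t x y
    exact hs t x y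
  obtain ⟨p, hp, h⟩ := exists_polynomial_word (k := k) r₀ r₁ r₂ n u
  simp only [(h _).1, (h _).2]
  rw [map_one, map_zero, eval_one_sub_eval_zero hc p hp]

end Quadrature

section Main

/-- The differential `lrD`, as a `k`-linear map on cochains. -/
noncomputable def lrDHom (D : LRConnection L W) (p : ℕ) :
    ((Fin (p + 1) → g) → W) →ₗ[k] (Fin (p + 2) → g) → W where
  toFun ψ := lrD D ψ
  map_add' ψ φ := by
    funext v
    simp only [lrD, Pi.add_apply, map_add, smul_add, Finset.sum_add_distrib]
    rw [add_add_add_comm]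
    congr 1
    rw [← Finset.sum_add_distrib]
    refine Finset.sum_congr rfl fun i _ => ?_
    rw [← Finset.sum_add_distrib]
    refine Finset.sum_congr rfl fun j _ => ?_
    split_ifs <;> simp
  map_smul' c ψ := by
    funext v
    simp only [lrD, Pi.smul_apply, map_smul, RingHom.id_apply, smul_add, Finset.smul_sum, smul_dite,
      smul_zero, smul_comm c]

theorem two_pow_smul_trace_powC [Module.Finite A W] [Module.Free A W] (D : LRConnection L W)
    (R : (Fin 2 → g) → Module.End A W) (hR : ∀ u w, R u w = curvK D (u 0) (u 1) w) (n : ℕ)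
    (v : Fin (2 * n) → g) :
    (2 ^ n : ℤ) • LinearMap.trace A W (powC R n v) =
      altSum (fun w => LinearMap.trace A W (word (fun x y => curv D x y) n (extend w))) v := by
  have h := two_pow_smul_powC R (fun x y => curv D x y)
    (fun x y => LinearMap.ext fun w => curvK_skew D x y w)
    (fun u => LinearMap.ext fun w => hR u w) n v
  rw [← map_zsmul, h]
  exact (altSum_map (LinearMap.trace A W).toAddMonoidHom _ v).symm

end Main

/-- the Chern character is independent of the choice of connection: for two
connections `∇₀, ∇₁` on a finite free module `W`, the cocycles `tr(R_{∇₀}^n)` and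
`tr(R_{∇₁}^n)` differ by a coboundary, so their classes in `H^{2n}(g,A)` agree. -/
theorem chern_character_independent_of_connection
    [Module.Finite A W] [Module.Free A W]
    (D0 D1 : LRConnection L W)
    (R0 R1 : (Fin 2 → g) → (W →ₗ[A] W))
    (hR0 : ∀ (u : Fin 2 → g) (w : W), R0 u w = curvK D0 (u 0) (u 1) w)
    (hR1 : ∀ (u : Fin 2 → g) (w : W), R1 u w = curvK D1 (u 0) (u 1) w)
    (n : ℕ) :
    ∃ η : AlternatingMap A g A (Fin (2 * n + 1)), ∀ v : Fin (2 * n + 2) → g,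
      LinearMap.trace A W (powC R1 (n + 1) (recast (by omega) v))
          - LinearMap.trace A W (powC R0 (n + 1) (recast (by omega) v))
        = lrD (anchorConnection L) ⇑η v := by
  obtain ⟨c, t, hc⟩ := exists_quadrature k (2 * (n + 1))
  let θ := diffConn D0 D1
  let D : k → LRConnection L W := interp D0 D1
  let f : Fin (2 * (n + 1)) → AlternatingMap A g A (Fin (2 * n + 1)) := fun i =>
    MultilinearMap.alternatization
      (transgression (LinearMap.trace A W) θ (curv (D (t i))) n)
  refine ⟨∑ i, ((2 ^ (n + 1) : k)⁻¹ * (2 * (n + 1) * c i)) • f i, fun v => ?_⟩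
  change LinearMap.trace A W (powC R1 (n + 1) v) - LinearMap.trace A W (powC R0 (n + 1) v) = _
  have hη : lrD (anchorConnection L)
      ⇑(∑ i, ((2 ^ (n + 1) : k)⁻¹ * (2 * (n + 1) * c i)) • f i) v =
      (2 ^ (n + 1) : k)⁻¹ • ∑ i, c i • (n + 1) • (2 : ℤ) • lrD (anchorConnection L) ⇑(f i) v := by
    have hcoe : ⇑(∑ i, ((2 ^ (n + 1) : k)⁻¹ * (2 * (n + 1) * c i)) • f i) =
        ∑ i, ((2 ^ (n + 1) : k)⁻¹ * (2 * (n + 1) * c i)) • ⇑(f i) := by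
      funext u
      let ev : AlternatingMap A g A (Fin (2 * n + 1)) →+ A :=
        { toFun := fun φ => φ u, map_zero' := rfl, map_add' := fun _ _ => rfl }
      change ev (∑ i, _) = _
      rw [map_sum, Finset.sum_apply]
      rfl
    change lrDHom (anchorConnection L) (2 * n) _ v = _
    rw [hcoe, map_sum, Finset.sum_apply, Finset.smul_sum]
    refine Finset.sum_congr rfl fun i _ => ?_
    rw [map_smul, Pi.smul_apply, ← Nat.cast_smul_eq_nsmul k, ← Int.cast_smul_eq_zsmul k, smul_smul,
      smul_smul, smul_smul]
    change _ = _ • lrDHom (anchorConnection L) (2 * n) _ v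
    congr 1
    push_cast
    ring
  have hT : ∀ a b : Module.End A W, (LinearMap.trace A W).toAddMonoidHom (a * b) =
      (LinearMap.trace A W).toAddMonoidHom (b * a) := LinearMap.trace_mul_comm A
  rw [hη, eq_inv_smul_iff₀ (pow_ne_zero _ two_ne_zero), smul_sub]
  have hcast : (2 ^ (n + 1) : k) = ((2 ^ (n + 1) : ℤ) : k) := by push_cast; rfl
  rw [hcast, Int.cast_smul_eq_zsmul, Int.cast_smul_eq_zsmul,
    two_pow_smul_trace_powC D1 R1 hR1, two_pow_smul_trace_powC D0 R0 hR0, ← altSum_sub,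
    ← curv_interp_one D0 D1, ← curv_interp_zero D0 D1]
  have hword := word_sub_word hc (fun t x y => curv (D t) x y) (fun t => curvDeriv (D t) θ)
    _ _ _ (curv_interp D0 D1) (curvDeriv_interp D0 D1)
  have hsum : ∀ u : ℕ → g,
      LinearMap.trace A W (word (fun x y => curv (D 1) x y) (n + 1) u) -
        LinearMap.trace A W (word (fun x y => curv (D 0) x y) (n + 1) u) =
      ∑ i, c i • LinearMap.trace A W (derivWord (fun x y => curv (D (t i)) x y)
        (curvDeriv (D (t i)) θ) (n + 1) u) := fun u => by
    rw [← map_sub, hword, map_sum]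
    simp only [LinearMap.map_smul_of_tower]
  have hterm : ∀ i, (n + 1) • (2 : ℤ) • lrD (anchorConnection L) ⇑(f i) v =
      altSum (fun w => LinearMap.trace A W (derivWord (fun x y => curv (D (t i)) x y)
        (curvDeriv (D (t i)) θ) (n + 1) (extend w))) v := fun i => by
    rw [two_smul_lrD_transgression]
    exact (altSum_derivWord _ hT _ _ n v).symm
  simp only [hterm]
  change altSum (fun w => LinearMap.trace A W (word (fun x y => curv (D 1) x y) (n + 1) (extend w)) -
    LinearMap.trace A W (word (fun x y => curv (D 0) x y) (n + 1) (extend w))) v = _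
  simp only [hsum, altSum, Finset.smul_sum]
  rw [Finset.sum_comm]
  refine Finset.sum_congr rfl fun i _ => Finset.sum_congr rfl fun σ _ => smul_comm _ _ _
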